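/- Mass Transport Principle in ℍ²: Let μ be a non-negative Borel measure on ℍ² × ℍ² invariant under the diagonal action of Isom(ℍ²), i.e., μ(gA × gB) = μ(A × B) for all measurable A, B and all isometries g. Suppose μ(A × ℍ²) < ∞ for some nonempty open A ⊆ ℍ². Then μ(B × ℍ²) = μ(ℍ² × B) for all measurable B ⊆ ℍ², and there is a constant c ≥ 0 such that μ(B × ℍ²) = c·area(B) for all measurable B. -/

import Mathlib

open MeasureTheory Set

noncomputable section

instance : MeasurableSpace UpperHalfPlane := borel UpperHalfPlane

instance : BorelSpace UpperHalfPlane := ⟨rfl⟩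

/-- The hyperbolic area measure on the hyperbolic plane `ℍ²` (upper half-plane model):
`dA = dx dy / y²`, pulled back along the inclusion `ℍ² ↪ ℂ`. -/
def hyperbolicArea : Measure UpperHalfPlane :=
  Measure.comap (UpperHalfPlane.coe)
    ((volume : Measure ℂ).withDensity fun z => ENNReal.ofReal (1 / z.im ^ 2))

open scoped MatrixGroups UpperHalfPlane

/-- Unfolding: if the `G`-translates of the weight `φ` integrate to one along every orbit, then the
integral of `f` against an invariant measure is the `φ`-weighted integral of its orbital
averages. -/
lemma lintegral_eq_lintegral_mul_lintegral_inv_smul {G X : Type*} [Group G]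
    [MeasurableSpace G] [MeasurableSpace X] [MulAction G X] [MeasurableInv G] [MeasurableSMul₂ G X]
    (m : Measure G) [SFinite m]
    (ν : Measure X) [SFinite ν] [SMulInvariantMeasure G X ν] {φ f : X → ENNReal}
    (hφ : Measurable φ) (hf : Measurable f) (h : ∀ x, ∫⁻ g : G, φ (g • x) ∂m = 1) :
    ∫⁻ x, f x ∂ν = ∫⁻ x, φ x * ∫⁻ g : G, f (g⁻¹ • x) ∂m ∂ν := by
  have hsm : Measurable fun p : G × X ↦ p.1 • p.2 := measurable_smul
  have hsm' : Measurable fun p : G × X ↦ p.1⁻¹ • p.2 := by fun_prop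
  calc ∫⁻ x, f x ∂ν = ∫⁻ x, ∫⁻ g : G, f x * φ (g • x) ∂m ∂ν := by
        refine lintegral_congr fun x ↦ ?_
        rw [lintegral_const_mul _ (by fun_prop), h, mul_one]
    _ = ∫⁻ g : G, ∫⁻ x, f x * φ (g • x) ∂ν ∂m := by
        refine lintegral_lintegral_swap (Measurable.aemeasurable ?_)
        exact (hf.comp measurable_fst).mul (hφ.comp (hsm.comp measurable_swap))
    _ = ∫⁻ g : G, ∫⁻ x, f (g⁻¹ • x) * φ x ∂ν ∂m := by
        refine lintegral_congr fun g ↦ ?_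
        have hm : Measurable fun x ↦ f (g⁻¹ • x) * φ x := by fun_prop
        rw [← (measurePreserving_smul g ν).lintegral_comp hm]
        simp
    _ = ∫⁻ x, ∫⁻ g : G, f (g⁻¹ • x) * φ x ∂m ∂ν := by
        refine lintegral_lintegral_swap (Measurable.aemeasurable ?_)
        exact (hf.comp hsm').mul (hφ.comp measurable_snd)
    _ = ∫⁻ x, φ x * ∫⁻ g : G, f (g⁻¹ • x) ∂m ∂ν := by
        refine lintegral_congr fun x ↦ ?_
        rw [lintegral_mul_const _ (by fun_prop), mul_comm]

/-- Orbital averages against a left-invariant measure are constant on orbits. -/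
lemma lintegral_inv_smul_smul {G X : Type*} [Group G] [MeasurableSpace G] [MeasurableMul G]
    [MulAction G X] (m : Measure G) [m.IsMulLeftInvariant] (f : X → ENNReal) (h : G) (x : X) :
    ∫⁻ g : G, f (g⁻¹ • h • x) ∂m = ∫⁻ g : G, f (g⁻¹ • x) ∂m := by
  rw [← lintegral_mul_left_eq_self _ h]
  simp [mul_smul]

namespace Matrix.SpecialLinearGroup

instance secondCountableTopology : SecondCountableTopology SL(2, ℝ) :=
  have : SecondCountableTopology (Matrix (Fin 2) (Fin 2) ℝ) :=
    inferInstanceAs (SecondCountableTopology (Fin 2 → Fin 2 → ℝ))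
  isClosedEmbedding_val.isEmbedding.secondCountableTopology

instance locallyCompactSpace : LocallyCompactSpace SL(2, ℝ) :=
  have : LocallyCompactSpace (Matrix (Fin 2) (Fin 2) ℝ) :=
    inferInstanceAs (LocallyCompactSpace (Fin 2 → Fin 2 → ℝ))
  isClosedEmbedding_val.locallyCompactSpace

lemma _root_.NNReal.eq_one_of_pow_eq_one {x : NNReal} {n : ℕ} (hn : n ≠ 0) (h : x ^ n = 1) :
    x = 1 := (pow_eq_one_iff_of_nonneg zero_le hn).mp h

/-- `SL(2, ℝ)` has no nontrivial characters with values in `ℝ≥0`. -/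
lemma monoidHom_nnreal_eq_one (χ : SL(2, ℝ) →* NNReal) (g : SL(2, ℝ)) : χ g = 1 := by
  let T (t : ℝ) : SL(2, ℝ) := ⟨!![1, t; 0, 1], by simp⟩
  let D : SL(2, ℝ) := ⟨!![2, 0; 0, 1 / 2], by simp⟩
  have hT (t : ℝ) : χ (T t) = 1 := by
    have hD : D * T t = T t ^ 4 * D := by
      refine Subtype.ext ?_
      rw [coe_mul, coe_mul, coe_pow]
      simp only [D, T, pow_succ, pow_zero, one_mul, Matrix.mul_fin_two]
      ext i j
      fin_cases i <;> fin_cases j <;> simp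
      ring
    have hχ := congrArg χ hD
    rw [map_mul, map_mul, map_pow, mul_comm] at hχ
    have hD0 : χ D ≠ 0 := (Group.isUnit D).map χ |>.ne_zero
    have hT0 : χ (T t) ≠ 0 := (Group.isUnit (T t)).map χ |>.ne_zero
    have h4 := mul_right_cancel₀ hD0 hχ
    refine NNReal.eq_one_of_pow_eq_one three_ne_zero (mul_left_cancel₀ hT0 ?_)
    rw [mul_one, ← pow_succ', ← h4]
  have hW (c : ℝ) (hc : c ≠ 0) (W : SL(2, ℝ)) (hW : W.1 = !![0, -c⁻¹; c, 0]) : χ W = 1 := by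
    have : W ^ 4 = 1 := by
      refine Subtype.ext ?_
      rw [coe_pow, hW]
      simp [pow_succ, Matrix.one_fin_two, hc]
    refine NNReal.eq_one_of_pow_eq_one four_ne_zero ?_
    rw [← map_pow, this, map_one]
  have key (g : SL(2, ℝ)) (hc : g 1 0 ≠ 0) : χ g = 1 := by
    induction g using fin_two_induction with | _ a b c d h
    replace hc : c ≠ 0 := by simpa using hc
    let W : SL(2, ℝ) := ⟨!![0, -c⁻¹; c, 0], by simp [hc]⟩
    have : (⟨!![a, b; c, d], by simpa using h⟩ : SL(2, ℝ)) = T (a / c) * W * T (d / c) := by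
      refine Subtype.ext ?_
      rw [coe_mul, coe_mul]
      simp only [T, W, Matrix.mul_fin_two]
      ext i j
      fin_cases i <;> fin_cases j <;> simp [hc] <;> field_simp
      linarith
    rw [this, map_mul, map_mul, hT, hT, hW c hc W rfl, one_mul, one_mul]
  by_cases hc : g 1 0 = 0
  · let S : SL(2, ℝ) := ⟨!![0, -1; 1, 0], by simp⟩
    have hd : g 1 1 ≠ 0 := by
      intro hd
      have := g.det_coe
      rw [Matrix.det_fin_two, hc, hd] at this
      simp at this
    have h1 : χ (g * S) = 1 := by
      refine key _ ?_
      rw [coe_mul, Matrix.eta_fin_two g.val, Matrix.mul_fin_two]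
      simpa using hd
    rwa [map_mul, key S (by simp [S]), mul_one] at h1
  · exact key g hc

end Matrix.SpecialLinearGroup

namespace UpperHalfPlane

/-- Any two points of the hyperbolic plane are swapped by the half-turn about their midpoint. -/
lemma exists_SL2_smul_swap (x y : ℍ) : ∃ g : SL(2, ℝ), g • x = y ∧ g • y = x := by
  set c := x.im + y.im with hc
  set a := x.re * y.im + x.im * y.re with ha
  set b := c * (x.re * y.re - x.im * y.im) - a * (x.re + y.re) with hb
  have hx := x.im_pos
  have hy := y.im_pos
  set D := -a ^ 2 - b * c with hD
  have hDeq : D = x.im * y.im * ((x.re - y.re) ^ 2 + c ^ 2) := by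
    rw [hD, hb, ha, hc]; ring
  have hDpos : 0 < D := by rw [hDeq]; positivity
  set r := (√D)⁻¹ with hr
  have hr0 : r ≠ 0 := by positivity
  have hrD : r ^ 2 * D = 1 := by
    rw [hr, inv_pow, Real.sq_sqrt hDpos.le, inv_mul_cancel₀ hDpos.ne']
  let g : SL(2, ℝ) := ⟨!![r * a, r * b; r * c, -(r * a)], by
    rw [Matrix.det_fin_two_of, ← hrD, hD]; ring⟩
  have hg : g • x = y := by
    ext
    rw [coe_specialLinearGroup_apply]
    have hden : ((r * c : ℝ) : ℂ) * x + ((-(r * a) : ℝ) : ℂ) ≠ 0 := by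
      intro h
      have him := congrArg Complex.im h
      have hc0 : c ≠ 0 := by positivity
      simp [hr0, hc0, x.im_ne_zero] at him
    change (((r * a : ℝ) : ℂ) * x + ((r * b : ℝ) : ℂ)) /
      (((r * c : ℝ) : ℂ) * x + ((-(r * a) : ℝ) : ℂ)) = y
    rw [div_eq_iff hden]
    apply Complex.ext
    · simp [hb, hc, ha]; ring
    · simp [hb, hc, ha]; ring
  have hgg : g * g = -1 := by
    refine Subtype.ext ?_
    rw [Matrix.SpecialLinearGroup.coe_mul, Matrix.SpecialLinearGroup.coe_neg,
      Matrix.SpecialLinearGroup.coe_one, Matrix.one_fin_two]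
    simp only [g, Matrix.mul_fin_two]
    ext i j
    fin_cases i <;> fin_cases j <;> simp <;> first | linear_combination -hrD | ring1
  refine ⟨g, hg, ?_⟩
  rw [← hg, ← mul_smul, hgg]
  ext
  simp [coe_specialLinearGroup_apply]

/-- `hyperbolicArea` is the invariant measure of the library, which is built on a propositionally
equal but distinct `MeasurableSpace` instance. -/
lemma hyperbolicArea_apply {s : Set ℍ} (hs : MeasurableSet s) :
    hyperbolicArea s = ∫⁻ z : ℂ in (↑) '' s, ↑((1 / ‖z.im‖₊) ^ 2 : NNReal) := by
  have he : MeasurableEmbedding UpperHalfPlane.coe := isOpenEmbedding_coe.measurableEmbedding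
  rw [hyperbolicArea, he.comap_apply, withDensity_apply _ (he.measurableSet_image.2 hs)]
  refine lintegral_congr fun z ↦ ?_
  rw [ENNReal.ofReal, ENNReal.coe_inj, ← NNReal.coe_inj, Real.coe_toNNReal _ (by positivity)]
  simp

lemma hyperbolicArea_eq_volume {s : Set ℍ} (hs : MeasurableSet s) :
    hyperbolicArea s = (MeasureSpace.volume : @Measure ℍ instMeasurableSpace) s := by
  rw [hyperbolicArea_apply hs, volume_eq_lintegral]

instance : SMulInvariantMeasure SL(2, ℝ) ℍ hyperbolicArea where
  measure_preimage_smul g s hs := by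
    rw [hyperbolicArea_eq_volume hs,
      hyperbolicArea_eq_volume ((continuous_const_smul g).measurable hs)]
    exact @measure_preimage_smul (GL (Fin 2) ℝ) ℍ instMeasurableSpace _ _ _ _
      (Matrix.SpecialLinearGroup.mapGL ℝ g) s

lemma hyperbolicArea_lt_top_of_isCompact {K : Set ℍ} (hK : IsCompact K) :
    hyperbolicArea K < ⊤ := by
  rw [hyperbolicArea_eq_volume hK.measurableSet]
  exact hK.measure_lt_top

instance : IsFiniteMeasureOnCompacts hyperbolicArea := ⟨fun _ ↦ hyperbolicArea_lt_top_of_isCompact⟩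

lemma hyperbolicArea_univ_ne_zero : hyperbolicArea univ ≠ 0 := by
  have he : MeasurableEmbedding UpperHalfPlane.coe := isOpenEmbedding_coe.measurableEmbedding
  rw [hyperbolicArea, he.comap_apply, Ne, withDensity_apply_eq_zero (by fun_prop)]
  have : {z : ℂ | ENNReal.ofReal (1 / z.im ^ 2) ≠ 0} ∩ UpperHalfPlane.coe '' univ
      = range UpperHalfPlane.coe := by
    rw [image_univ, inter_eq_right]
    rintro _ ⟨z, rfl⟩
    simp [z.im_ne_zero]
  rw [this]
  exact (isOpenEmbedding_coe.isOpen_range.measure_pos _ (range_nonempty _)).ne'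

/-- `SL(2, ℝ)` is unimodular. -/
lemma isMulRightInvariant_SL2 [MeasurableSpace SL(2, ℝ)] [BorelSpace SL(2, ℝ)]
    (m : Measure SL(2, ℝ)) [m.IsHaarMeasure] : m.IsMulRightInvariant where
  map_mul_right_eq_self g := by
    rw [Measure.map_right_mul_eq_modularCharacterFun_smul]
    have : Measure.modularCharacterFun g = 1 :=
      Matrix.SpecialLinearGroup.monoidHom_nnreal_eq_one Measure.modularCharacter g
    rw [this, one_smul]

/-- There is a weight on `ℍ` of finite total area whose translates integrate to one along every
orbit of `SL(2, ℝ)`. -/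
lemma exists_weight [MeasurableSpace SL(2, ℝ)] [BorelSpace SL(2, ℝ)]
    (m : Measure SL(2, ℝ)) [m.IsHaarMeasure] :
    ∃ φ : ℍ → ENNReal, Measurable φ ∧ (∀ x, ∫⁻ g : SL(2, ℝ), φ (g • x) ∂m = 1) ∧
      ∫⁻ x, φ x ∂hyperbolicArea ≠ ⊤ := by
  have := isMulRightInvariant_SL2 m
  set K : Set ℍ := Metric.closedBall I 1
  have hK : IsCompact K := isCompact_closedBall I 1
  set k := m ((fun g : SL(2, ℝ) ↦ g • I) ⁻¹' K)
  have hk (x : ℍ) : ∫⁻ g : SL(2, ℝ), K.indicator 1 (g • x) ∂m = k := by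
    obtain ⟨h, rfl⟩ := MulAction.exists_smul_eq SL(2, ℝ) I x
    have hpre : (fun g : SL(2, ℝ) ↦ g • h • I) ⁻¹' K =
        (· * h) ⁻¹' ((fun g : SL(2, ℝ) ↦ g • I) ⁻¹' K) := by
      ext g
      rw [mem_preimage, mem_preimage, mem_preimage, mul_smul]
    have hm : MeasurableSet ((fun g : SL(2, ℝ) ↦ g • h • I) ⁻¹' K) :=
      (hK.isClosed.preimage (by fun_prop)).measurableSet
    calc ∫⁻ g : SL(2, ℝ), K.indicator 1 (g • h • I) ∂m
        = ∫⁻ g : SL(2, ℝ), ((fun g : SL(2, ℝ) ↦ g • h • I) ⁻¹' K).indicator 1 g ∂m :=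
          lintegral_congr fun g ↦ by classical simp [indicator_apply]
      _ = k := by rw [lintegral_indicator_one hm, hpre, measure_preimage_mul_right]
  have hk0 : k ≠ 0 := by
    have hU : IsOpen ((fun g : SL(2, ℝ) ↦ g • I) ⁻¹' Metric.ball I 1) :=
      Metric.isOpen_ball.preimage (by fun_prop)
    refine ((hU.measure_pos m ⟨1, by simp⟩).trans_le (measure_mono ?_)).ne'
    exact preimage_mono Metric.ball_subset_closedBall
  have hkt : k ≠ ⊤ := (isProperMap_smul_I.isCompact_preimage hK).measure_lt_top.ne
  have hm1 : Measurable (K.indicator (1 : ℍ → ENNReal)) :=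
    measurable_one.indicator hK.measurableSet
  refine ⟨fun x ↦ k⁻¹ * K.indicator 1 x, hm1.const_mul _, fun x ↦ ?_, ?_⟩
  · rw [lintegral_const_mul k⁻¹ (f := fun g : SL(2, ℝ) ↦ K.indicator 1 (g • x))
      (hm1.comp (measurable_smul_const x)), hk, ENNReal.inv_mul_cancel hk0 hkt]
  · rw [lintegral_const_mul _ hm1, lintegral_indicator_one hK.measurableSet]
    exact ENNReal.mul_ne_top (ENNReal.inv_ne_top.2 hk0)
      (hyperbolicArea_lt_top_of_isCompact hK).ne

/-- The hyperbolic area is, up to scaling, the only invariant `s`-finite measure. -/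
lemma exists_eq_smul_hyperbolicArea (ν : Measure ℍ) [SFinite ν]
    [SMulInvariantMeasure SL(2, ℝ) ℍ ν] : ∃ c : ENNReal, ν = c • hyperbolicArea := by
  borelize SL(2, ℝ)
  let m : Measure SL(2, ℝ) := Measure.haar
  obtain ⟨φ, hφ, h1, hφt⟩ := exists_weight m
  have key (ρ : Measure ℍ) [SFinite ρ] [SMulInvariantMeasure SL(2, ℝ) ℍ ρ] (s : Set ℍ)
      (hs : MeasurableSet s) : ρ s = (∫⁻ x, φ x ∂ρ) *
        ∫⁻ g : SL(2, ℝ), s.indicator 1 (g⁻¹ • I) ∂m := by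
    rw [← lintegral_indicator_one hs, lintegral_eq_lintegral_mul_lintegral_inv_smul m ρ hφ
      (measurable_one.indicator hs) h1, ← lintegral_mul_const _ hφ]
    refine lintegral_congr fun x ↦ ?_
    obtain ⟨h, rfl⟩ := MulAction.exists_smul_eq SL(2, ℝ) I x
    rw [lintegral_inv_smul_smul]
  have h0 : ∫⁻ x, φ x ∂hyperbolicArea ≠ 0 := fun h ↦
    hyperbolicArea_univ_ne_zero (by rw [key _ _ .univ, h, zero_mul])
  refine ⟨(∫⁻ x, φ x ∂ν) / ∫⁻ x, φ x ∂hyperbolicArea, Measure.ext fun s hs ↦ ?_⟩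
  rw [Measure.smul_apply, smul_eq_mul, key ν s hs, key hyperbolicArea s hs, ← mul_assoc,
    ENNReal.div_mul_cancel h0 hφt]

/-- A diagonally invariant measure on `ℍ × ℍ` is invariant under exchanging the coordinates. -/
lemma map_swap_eq_self (μ : Measure (ℍ × ℍ)) [SFinite μ]
    [SMulInvariantMeasure SL(2, ℝ) (ℍ × ℍ) μ] : μ.map Prod.swap = μ := by
  borelize SL(2, ℝ)
  let m : Measure SL(2, ℝ) := Measure.haar
  obtain ⟨φ, hφ, h1, -⟩ := exists_weight m
  have : MeasurableSMul₂ SL(2, ℝ) (ℍ × ℍ) :=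
    ⟨(by fun_prop : Continuous fun p : SL(2, ℝ) × ℍ × ℍ ↦ p.1 • p.2).measurable⟩
  refine Measure.ext_of_lintegral _ fun f hf ↦ ?_
  have hφ' : Measurable fun p : ℍ × ℍ ↦ φ p.1 := hφ.comp measurable_fst
  rw [lintegral_map hf measurable_swap,
    lintegral_eq_lintegral_mul_lintegral_inv_smul m μ hφ' (f := fun p ↦ f p.swap)
      (hf.comp measurable_swap) (fun p ↦ h1 p.1),
    lintegral_eq_lintegral_mul_lintegral_inv_smul m μ hφ' hf (fun p ↦ h1 p.1)]
  refine lintegral_congr fun p ↦ ?_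
  obtain ⟨h, hxy, hyx⟩ := exists_SL2_smul_swap p.1 p.2
  have hp : h • p = p.swap := Prod.ext hxy hyx
  rw [← lintegral_inv_smul_smul m f h p, hp]
  rfl

end UpperHalfPlane

/-- Mass Transport Principle in `ℍ²`: let `μ` be a non-negative Borel
measure on `ℍ² × ℍ²` invariant under the diagonal action of `Isom(ℍ²)`, i.e.
`μ(gA × gB) = μ(A × B)` for all measurable `A, B` and all isometries `g`.  If
`μ(A × ℍ²) < ∞` for some nonempty open `A`, then `μ(B × ℍ²) = μ(ℍ² × B)` for every
measurable `B`, and there is a constant `c` with `μ(B × ℍ²) = c · area(B)` for every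
measurable `B`. -/
theorem mass_transport_principle_H2
    (μ : Measure (UpperHalfPlane × UpperHalfPlane))
    (hinv : ∀ (g : UpperHalfPlane ≃ᵢ UpperHalfPlane) (A B : Set UpperHalfPlane),
      MeasurableSet A → MeasurableSet B →
        μ ((g '' A) ×ˢ (g '' B)) = μ (A ×ˢ B))
    (hfin : ∃ A : Set UpperHalfPlane, IsOpen A ∧ A.Nonempty ∧ μ (A ×ˢ univ) < ⊤) :
    (∀ B : Set UpperHalfPlane, MeasurableSet B → μ (B ×ˢ univ) = μ (univ ×ˢ B)) ∧
      ∃ c : ENNReal, ∀ B : Set UpperHalfPlane, MeasurableSet B →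
        μ (B ×ˢ univ) = c * hyperbolicArea B := by
  have hpre (g : SL(2, ℝ)) (A B : Set ℍ) (hA : MeasurableSet A) (hB : MeasurableSet B) :
      μ (((g • ·) ⁻¹' A) ×ˢ ((g • ·) ⁻¹' B)) = μ (A ×ˢ B) := by
    rw [← hinv (IsometryEquiv.constSMul g) _ _ (measurable_const_smul g hA)
      (measurable_const_smul g hB)]
    congr 2 <;> exact image_preimage_eq _ (IsometryEquiv.constSMul g).surjective
  have hν (B : Set ℍ) (hB : MeasurableSet B) : μ.map Prod.fst B = μ (B ×ˢ univ) := by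
    rw [Measure.map_apply measurable_fst hB, prod_univ]
  have : SMulInvariantMeasure SL(2, ℝ) ℍ (μ.map Prod.fst) := ⟨fun g B hB ↦ by
    rw [hν _ hB, hν _ (measurable_const_smul g hB), ← hpre g B univ hB .univ, preimage_univ]⟩
  have : IsLocallyFiniteMeasure (μ.map Prod.fst) := by
    obtain ⟨A, hA, ⟨a, ha⟩, hμA⟩ := hfin
    refine ⟨fun x ↦ ?_⟩
    obtain ⟨g, hg⟩ := MulAction.exists_smul_eq SL(2, ℝ) x a
    refine ⟨(g • ·) ⁻¹' A, (hA.preimage (continuous_const_smul g)).mem_nhds (by simpa [hg]), ?_⟩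
    rwa [measure_preimage_smul, hν A hA.measurableSet]
  have : SigmaFinite μ := .of_map μ measurable_fst.aemeasurable inferInstance
  have : SMulInvariantMeasure SL(2, ℝ) (ℍ × ℍ) μ := by
    refine ((smulInvariantMeasure_tfae SL(2, ℝ) μ).out 0 5).2 fun g ↦ Eq.symm ?_
    have hS (n : ℕ) : MeasurableSet (spanningSets (μ.map Prod.fst) n) :=
      measurableSet_spanningSets _ n
    refine Measure.ext_of_generateFrom_of_iUnion _
      (fun n ↦ spanningSets (μ.map Prod.fst) n ×ˢ univ) generateFrom_prod.symm isPiSystem_prod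
      ?_ (fun n ↦ ⟨_, hS n, univ, by simp, rfl⟩) (fun n ↦ ?_) ?_
    · rw [← iUnion_prod_const, iUnion_spanningSets, univ_prod_univ]
    · rw [← hν _ (hS n)]
      exact (measure_spanningSets_lt_top _ n).ne
    · rintro _ ⟨A, hA, B, hB, rfl⟩
      rw [mem_ofPred_eq] at hA hB
      rw [Measure.map_apply (measurable_const_smul g) (hA.prod hB), ← hpre g A B hA hB]
      rfl
  refine ⟨fun B hB ↦ ?_, ?_⟩
  · conv_lhs => rw [← UpperHalfPlane.map_swap_eq_self μ]
    rw [Measure.map_apply measurable_swap (hB.prod .univ), preimage_swap_prod]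
  · obtain ⟨c, hc⟩ := UpperHalfPlane.exists_eq_smul_hyperbolicArea (μ.map Prod.fst)
    refine ⟨c, fun B hB ↦ ?_⟩
    rw [← hν B hB, hc, Measure.smul_apply, smul_eq_mul]
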